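/- Under the hypotheses of the bivariate phase-type mixed Poisson model — T₁₁ (p₁ × p₁) and T₂₂ (p₂ × p₂) real matrices with all complex eigenvalues having negative real part, T₁₂ a p₁ × p₂ real matrix, η a row vector in ℝ^{p₁}, exposures e_{•1}, e_{•2} > 0 and observed totals y_{•1}, y_{•2} ∈ ℕ₀ — for all k, s ∈ ℕ₀ the posterior cross moments satisfy: [∫_0^∞ ∫_0^∞ θ₁^k θ₂^s θ₁^{y_{•1}} θ₂^{y_{•2}} e^{-θ₁ e_{•1} - θ₂ e_{•2}} η e^{T₁₁θ₁} T₁₂ e^{T₂₂θ₂} (−T₂₂)𝟙 dθ₁ dθ₂] / [∫_0^∞ ∫_0^∞ θ₁^{y_{•1}} θ₂^{y_{•2}} e^{-θ₁ e_{•1} - θ₂ e_{•2}} η e^{T₁₁θ₁} T₁₂ e^{T₂₂θ₂} (−T₂₂)𝟙 dθ₁ dθ₂] = [(y_{•1}+k)! (y_{•2}+s)! / (y_{•1}! y_{•2}!)] · [η (e_{•1}I − T₁₁)^{-(y_{•1}+k+1)} T₁₂ (e_{•2}I − T₂₂)^{-(y_{•2}+s+1)} (−T₂₂)𝟙] / [η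 (e_{•1}I − T₁₁)^{-(y_{•1}+1)} T₁₂ (e_{•2}I − T₂₂)^{-(y_{•2}+1)} (−T₂₂)𝟙], provided the denominator is nonzero. In probabilistic terms, this is the formula for E(Θ₁^k Θ₂^s ∣ Y = y) in the bivariate phase-type mixed Poisson model. -/

import Mathlib

open MeasureTheory Real Set Matrix Finset

/-- The matrix exponential `e^M = Σ_{r ≥ 0} M^r / r!`. -/
noncomputable def matExp {p : ℕ} (M : Matrix (Fin p) (Fin p) ℝ) :
    Matrix (Fin p) (Fin p) ℝ :=
  ∑' r : ℕ, ((r.factorial : ℝ)⁻¹) • M ^ r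

section PhaseType

open scoped Matrix.Norms.Operator Topology
open Filter Asymptotics

theorem matExp_eq_exp {p : ℕ} (M : Matrix (Fin p) (Fin p) ℝ) : matExp M = NormedSpace.exp M := by
  rw [NormedSpace.exp_eq_tsum ℝ]
  rfl

/-- On a generalized eigenvector, the matrix exponential is a scalar exponential times a
vector-valued polynomial. -/
theorem exp_smul_mulVec_of_pow_mulVec_eq_zero {n : Type*} [Fintype n] [DecidableEq n]
    (B : Matrix n n ℂ) (μ : ℂ) (k : ℕ) (v : n → ℂ) (hv : (B - μ • 1) ^ k *ᵥ v = 0) (t : ℝ) :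
    NormedSpace.exp (t • B) *ᵥ v = Complex.exp (t * μ) •
      ∑ r ∈ Finset.range k, ((t : ℂ) ^ r) • (((r.factorial : ℂ)⁻¹) • ((B - μ • 1) ^ r *ᵥ v)) := by
  set N := B - μ • (1 : Matrix n n ℂ) with hN
  have hexp : NormedSpace.exp (t • B) = Complex.exp (t * μ) • NormedSpace.exp ((t : ℂ) • N) := by
    have h1 : t • B = algebraMap ℂ (Matrix n n ℂ) (t * μ) + (t : ℂ) • N := by
      rw [hN, Algebra.algebraMap_eq_smul_one, smul_sub, smul_smul, add_sub_cancel, Complex.coe_smul]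
    have h2 : NormedSpace.exp (algebraMap ℂ (Matrix n n ℂ) (t * μ))
        = algebraMap ℂ (Matrix n n ℂ) (NormedSpace.exp (t * μ)) :=
      (NormedSpace.algebraMap_exp_comm (𝔸 := Matrix n n ℂ) _).symm
    rw [h1, Matrix.exp_add_of_commute _ _ (Algebra.commute_algebraMap_left _ _), h2,
      ← Complex.exp_eq_exp_ℂ, Algebra.algebraMap_eq_smul_one, smul_mul_assoc, one_mul]
  have hsum := (LinearMap.toContinuousLinearMap
    ((Matrix.mulVecBilin ℂ ℂ).flip v : Matrix n n ℂ →ₗ[ℂ] n → ℂ)).hasSum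
      (NormedSpace.exp_series_hasSum_exp' (𝕂 := ℂ) ((t : ℂ) • N))
  have hfin := hsum.unique (hasSum_sum_of_ne_finset_zero (s := Finset.range k) (by
    intro r hr
    obtain ⟨d, rfl⟩ := Nat.exists_eq_add_of_le (not_lt.mp (mt Finset.mem_range.mpr hr))
    rw [add_comm k d, LinearMap.coe_toContinuousLinearMap', LinearMap.flip_apply,
      Matrix.mulVecBilin_apply, smul_pow, pow_add N, Matrix.smul_mulVec, Matrix.smul_mulVec,
      ← Matrix.mulVec_mulVec, hv, Matrix.mulVec_zero, smul_zero, smul_zero]))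
  simp only [LinearMap.coe_toContinuousLinearMap', LinearMap.flip_apply,
    Matrix.mulVecBilin_apply] at hfin
  rw [hexp, Matrix.smul_mulVec]
  congr 1
  refine hfin.trans ?_
  refine Finset.sum_congr rfl fun r _ => ?_
  rw [smul_pow, Matrix.smul_mulVec, Matrix.smul_mulVec, smul_comm]

theorem exp_smul_mulVec_isBigO_one {n : Type*} [Fintype n] [DecidableEq n] (B : Matrix n n ℂ)
    (hB : ∀ z ∈ spectrum ℂ B, z.re < 0) (v : n → ℂ) :
    (fun t : ℝ => NormedSpace.exp (t • B) *ᵥ v) =O[atTop] (fun _ => (1 : ℝ)) := by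
  have hv : v ∈ ⨆ μ, Module.End.maxGenEigenspace (Matrix.toLin' B) μ := by
    rw [Module.End.iSup_maxGenEigenspace_eq_top]; trivial
  refine Submodule.iSup_induction _ (motive := fun v => (fun t : ℝ =>
    NormedSpace.exp (t • B) *ᵥ v) =O[atTop] (fun _ => (1 : ℝ))) hv (fun μ v hv => ?_) ?_ ?_
  rotate_left
  · simp only [Matrix.mulVec_zero]
    exact isBigO_zero _ _
  · intro x y hx hy
    simpa only [Matrix.mulVec_add] using hx.add hy
  · obtain rfl | hv0 := eq_or_ne v 0
    · simp only [Matrix.mulVec_zero]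
      exact isBigO_zero _ _
    have hμ : μ.re < 0 := by
      refine hB μ ?_
      rw [← Matrix.spectrum_toLin', ← Module.End.hasEigenvalue_iff_mem_spectrum]
      exact Module.End.HasUnifEigenvalue.lt (k := ⊤) zero_lt_one
        ((Submodule.ne_bot_iff _).mpr ⟨v, hv, hv0⟩)
    obtain ⟨k, hk⟩ := (Module.End.mem_maxGenEigenspace _ _ _).mp hv
    have hk' : (B - μ • 1) ^ k *ᵥ v = 0 := by
      rw [← Matrix.toLin'_apply, Matrix.toLin'_pow, map_sub, map_smul, Matrix.toLin'_one]
      exact hk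
    simp_rw [exp_smul_mulVec_of_pow_mulVec_eq_zero B μ k v hk', Finset.smul_sum]
    refine IsBigO.fun_sum fun r _ => ?_
    have h1 : (fun t : ℝ => Complex.exp (t * μ) * (t : ℂ) ^ r) =O[atTop] (fun _ => (1 : ℝ)) := by
      have h2 := (isBigO_refl (fun t : ℝ => Real.exp (μ.re * t)) atTop).mul
        (isLittleO_pow_exp_pos_mul_atTop r (neg_pos.mpr hμ)).isBigO
      refine IsBigO.trans (IsBigO.of_norm_eventuallyLE ?_) (h2.congr_right fun t => ?_)
      · filter_upwards [eventually_ge_atTop 0] with t ht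
        simp [abs_of_nonneg ht, Complex.norm_exp, mul_comm]
      · rw [← Real.exp_add]; simp
    exact (h1.smul (isBigO_const_const ((r.factorial : ℂ)⁻¹ • ((B - μ • 1) ^ r *ᵥ v))
      (one_ne_zero' ℝ) atTop)).congr (fun t => mul_smul _ _ _) (fun _ => mul_one _)

theorem exp_smul_isBigO_one {p : ℕ} (T : Matrix (Fin p) (Fin p) ℝ)
    (hT : ∀ z ∈ spectrum ℂ (T.map Complex.ofReal), z.re < 0) :
    (fun t : ℝ => NormedSpace.exp (t • T)) =O[atTop] (fun _ => (1 : ℝ)) := by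
  have hmap (t : ℝ) : (NormedSpace.exp (t • T)).map Complex.ofReal
      = NormedSpace.exp (t • T.map Complex.ofReal) := by
    have h := NormedSpace.map_exp (Complex.ofRealHom.mapMatrix (m := Fin p))
      (continuous_id.matrix_map Complex.continuous_ofReal) (t • T)
    refine h.trans (congrArg _ ?_)
    ext i j
    simp
  have hentry (i j : Fin p) :
      (fun t : ℝ => NormedSpace.exp (t • T) i j) =O[atTop] (fun _ => (1 : ℝ)) := by
    refine IsBigO.trans (IsBigO.of_norm_eventuallyLE ?_)
      (exp_smul_mulVec_isBigO_one _ hT (Pi.single j 1)).norm_left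
    filter_upwards with t
    refine le_trans ?_ (norm_le_pi_norm _ i)
    rw [← hmap]
    simp
  have hsum (t : ℝ) : NormedSpace.exp (t • T)
      = ∑ i, ∑ j, NormedSpace.exp (t • T) i j • Matrix.single i j (1 : ℝ) := by
    conv_lhs => rw [Matrix.matrix_eq_sum_single (NormedSpace.exp (t • T))]
    simp only [Matrix.smul_single, smul_eq_mul, mul_one]
  rw [funext hsum]
  refine IsBigO.fun_sum fun i _ => IsBigO.fun_sum fun j _ => ?_
  simpa using (hentry i j).smul
    (isBigO_const_const (Matrix.single i j (1 : ℝ)) (one_ne_zero' ℝ) atTop)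

section LaplaceMoments

variable {𝔸 : Type*} [NormedRing 𝔸] [NormedAlgebra ℝ 𝔸] {E : ℝ → 𝔸} {a : 𝔸} {e : ℝ}

theorem pow_mul_exp_smul_isBigO (hO : E =O[atTop] (fun _ => (1 : ℝ))) (he : 0 < e) (n : ℕ) :
    (fun t : ℝ => (t ^ n * Real.exp (-(t * e))) • E t)
      =O[atTop] (fun t => Real.exp (-(e / 2) * t)) := by
  have h := ((isLittleO_pow_exp_pos_mul_atTop n (half_pos he)).isBigO.mul
    (isBigO_refl (fun t : ℝ => Real.exp (-(t * e))) atTop)).smul hO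
  refine h.congr_right fun t => ?_
  rw [smul_eq_mul, mul_one, ← Real.exp_add]
  ring_nf

theorem integrableOn_pow_mul_exp_smul (hE : Continuous E)
    (hO : E =O[atTop] (fun _ => (1 : ℝ))) (he : 0 < e) (n : ℕ) :
    IntegrableOn (fun t : ℝ => (t ^ n * Real.exp (-(t * e))) • E t) (Set.Ioi 0) := by
  have hcont : Continuous (fun t : ℝ => (t ^ n * Real.exp (-(t * e))) • E t) := by fun_prop
  exact integrableOn_Ici_iff_integrableOn_Ioi (by finiteness) |>.mp <|
    (hcont.continuousOn.locallyIntegrableOn measurableSet_Ici).integrableOn_of_isBigO_atTop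
    (pow_mul_exp_smul_isBigO hO he n)
    ⟨Set.Ioi (e / 2), Ioi_mem_atTop _, exp_neg_integrableOn_Ioi _ (half_pos he)⟩

theorem tendsto_pow_mul_exp_smul (hO : E =O[atTop] (fun _ => (1 : ℝ))) (he : 0 < e) (n : ℕ) :
    Tendsto (fun t : ℝ => (t ^ n * Real.exp (-(t * e))) • E t) atTop (𝓝 0) :=
  (pow_mul_exp_smul_isBigO hO he n).trans_tendsto
    (Real.tendsto_exp_atBot.comp (tendsto_id.const_mul_atTop_of_neg (by linarith)))

theorem hasDerivAt_pow_mul_exp_smul (hE : ∀ t, HasDerivAt E (E t * a) t) (e : ℝ) (n : ℕ)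
    (t : ℝ) :
    HasDerivAt (fun t : ℝ => (t ^ n * Real.exp (-(t * e))) • E t)
      ((n : ℝ) • ((t ^ (n - 1) * Real.exp (-(t * e))) • E t)
        - ((t ^ n * Real.exp (-(t * e))) • E t) * (e • 1 - a)) t := by
  have h1 : HasDerivAt (fun t : ℝ => Real.exp (-(t * e))) (Real.exp (-(t * e)) * -e) t := by
    simpa using ((hasDerivAt_id t).mul_const e).neg.exp
  refine (((hasDerivAt_pow n t).mul h1).smul (hE t)).congr_deriv ?_
  simp only [mul_sub, smul_mul_assoc, mul_smul_comm, mul_one, Pi.mul_apply]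
  module

variable [CompleteSpace 𝔸]

theorem integral_pow_mul_exp_smul_mul (hE : ∀ t, HasDerivAt E (E t * a) t) (hE0 : E 0 = 1)
    (hO : E =O[atTop] (fun _ => (1 : ℝ))) (he : 0 < e) (n : ℕ) :
    (∫ t in Set.Ioi (0 : ℝ), (t ^ n * Real.exp (-(t * e))) • E t) * (e • 1 - a)
      = (n : ℝ) • (∫ t in Set.Ioi (0 : ℝ), (t ^ (n - 1) * Real.exp (-(t * e))) • E t)
        + (0 : ℝ) ^ n • 1 := by
  have hcont : Continuous E := continuous_iff_continuousAt.mpr fun t => (hE t).continuousAt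
  have hi (m : ℕ) := integrableOn_pow_mul_exp_smul hcont hO he m
  have hi₁ : IntegrableOn (fun t : ℝ =>
      (n : ℝ) • ((t ^ (n - 1) * Real.exp (-(t * e))) • E t)) (Set.Ioi 0) :=
    (hi (n - 1)).smul (n : ℝ)
  have hi₂ : IntegrableOn (fun t : ℝ =>
      ((t ^ n * Real.exp (-(t * e))) • E t) * (e • 1 - a)) (Set.Ioi 0) :=
    (hi n).mul_const (e • 1 - a)
  have h := integral_Ioi_of_hasDerivAt_of_tendsto'
    (fun t _ => hasDerivAt_pow_mul_exp_smul hE e n t) (hi₁.sub hi₂)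
    (tendsto_pow_mul_exp_smul hO he n)
  rw [integral_sub hi₁ hi₂, integral_smul, integral_mul_const_of_integrable (hi n)] at h
  simp only [zero_mul, neg_zero, Real.exp_zero, mul_one, hE0, zero_sub] at h
  rw [sub_eq_iff_eq_add] at h
  rw [h]
  abel

/-- The gamma integral of a one-parameter semigroup with generator `a`, in terms of a right
inverse of `e - a`. -/
theorem integral_pow_mul_exp_smul (hE : ∀ t, HasDerivAt E (E t * a) t) (hE0 : E 0 = 1)
    (hO : E =O[atTop] (fun _ => (1 : ℝ))) (he : 0 < e) {R : 𝔸} (hR : (e • 1 - a) * R = 1)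
    (n : ℕ) :
    ∫ t in Set.Ioi (0 : ℝ), (t ^ n * Real.exp (-(t * e))) • E t
      = (n.factorial : ℝ) • R ^ (n + 1) := by
  have key (X Y : 𝔸) (h : X * (e • 1 - a) = Y) : X = Y * R := by
    rw [← h, mul_assoc, hR, mul_one]
  induction n with
  | zero =>
    rw [key _ _ (integral_pow_mul_exp_smul_mul hE hE0 hO he 0)]
    simp
  | succ n ih =>
    rw [key _ _ (integral_pow_mul_exp_smul_mul hE hE0 hO he (n + 1)), Nat.add_sub_cancel, ih,
      pow_succ _ (n + 1), Nat.factorial_succ]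
    simp [smul_smul]

theorem integral_pow_mul_exp_mul_linearMap [FiniteDimensional ℝ 𝔸]
    (hE : ∀ t, HasDerivAt E (E t * a) t) (hE0 : E 0 = 1)
    (hO : E =O[atTop] (fun _ => (1 : ℝ))) (he : 0 < e) {R : 𝔸} (hR : (e • 1 - a) * R = 1)
    (φ : 𝔸 →ₗ[ℝ] ℝ) (n : ℕ) :
    ∫ t in Set.Ioi (0 : ℝ), t ^ n * Real.exp (-(t * e)) * φ (E t)
      = n.factorial * φ (R ^ (n + 1)) := by
  have hcont : Continuous E := continuous_iff_continuousAt.mpr fun t => (hE t).continuousAt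
  have h := (LinearMap.toContinuousLinearMap φ).integral_comp_comm
    (integrableOn_pow_mul_exp_smul hcont hO he n)
  rw [integral_pow_mul_exp_smul hE hE0 hO he hR] at h
  simpa using h

theorem exists_mul_sub_eq_one (hE : ∀ t, HasDerivAt E (E t * a) t) (hE0 : E 0 = 1)
    (hO : E =O[atTop] (fun _ => (1 : ℝ))) (he : 0 < e) : ∃ R : 𝔸, R * (e • 1 - a) = 1 :=
  ⟨_, (integral_pow_mul_exp_smul_mul hE hE0 hO he 0).trans (by simp)⟩

end LaplaceMoments

/-- The matrix gamma integral, tested against a linear functional. -/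
theorem integral_pow_mul_exp_mul_matExp {p : ℕ} (T : Matrix (Fin p) (Fin p) ℝ)
    (hT : ∀ z ∈ spectrum ℂ (T.map Complex.ofReal), z.re < 0) {e : ℝ} (he : 0 < e)
    (φ : Matrix (Fin p) (Fin p) ℝ →ₗ[ℝ] ℝ) (n : ℕ) :
    ∫ t in Set.Ioi (0 : ℝ), t ^ n * Real.exp (-(t * e)) * φ (matExp (t • T))
      = n.factorial * φ ((e • 1 - T)⁻¹ ^ (n + 1)) := by
  have hO : (fun t : ℝ => matExp (t • T)) =O[atTop] (fun _ => (1 : ℝ)) := by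
    simpa only [matExp_eq_exp] using exp_smul_isBigO_one T hT
  have hE0 : matExp ((0 : ℝ) • T) = 1 := by
    rw [matExp_eq_exp, zero_smul, NormedSpace.exp_zero]
  have hE (t : ℝ) := hasDerivAt_exp_smul_const (𝕂 := ℝ) T t
  obtain ⟨R, hR⟩ := exists_mul_sub_eq_one (E := fun t => matExp (t • T)) (a := T)
    (fun t => by simp only [matExp_eq_exp]; exact hE t) hE0 hO he
  rw [Matrix.inv_eq_left_inv hR]
  exact integral_pow_mul_exp_mul_linearMap (E := fun t => matExp (t • T)) (a := T)
    (fun t => by simp only [matExp_eq_exp]; exact hE t) hE0 hO he (mul_eq_one_comm.mp hR) φ n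

theorem phase_type_double_integral {p₁ p₂ : ℕ} (T₁₁ : Matrix (Fin p₁) (Fin p₁) ℝ)
    (hT₁₁ : ∀ z ∈ spectrum ℂ (T₁₁.map Complex.ofReal), z.re < 0)
    (T₂₂ : Matrix (Fin p₂) (Fin p₂) ℝ)
    (hT₂₂ : ∀ z ∈ spectrum ℂ (T₂₂.map Complex.ofReal), z.re < 0)
    (T₁₂ : Matrix (Fin p₁) (Fin p₂) ℝ) (η : Fin p₁ → ℝ) (w : Fin p₂ → ℝ)
    {e₁ e₂ : ℝ} (he₁ : 0 < e₁) (he₂ : 0 < e₂) (m n : ℕ) :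
    ∫ θ₁ in Set.Ioi (0 : ℝ), ∫ θ₂ in Set.Ioi (0 : ℝ),
        θ₁ ^ m * θ₂ ^ n * Real.exp (-(θ₁ * e₁) - θ₂ * e₂)
          * (η ⬝ᵥ ((matExp (θ₁ • T₁₁) * T₁₂ * matExp (θ₂ • T₂₂) * (-T₂₂)) *ᵥ w))
      = (m.factorial : ℝ) * n.factorial
        * (η ⬝ᵥ (((e₁ • 1 - T₁₁)⁻¹ ^ (m + 1) * T₁₂ * (e₂ • 1 - T₂₂)⁻¹ ^ (n + 1) * (-T₂₂))
          *ᵥ w)) := by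
  let L₂ (X : Matrix (Fin p₁) (Fin p₁) ℝ) : Matrix (Fin p₂) (Fin p₂) ℝ →ₗ[ℝ] ℝ :=
    { toFun := fun Y => η ⬝ᵥ ((X * T₁₂ * Y * (-T₂₂)) *ᵥ w)
      map_add' := fun Y Z => by
        rw [Matrix.mul_add, Matrix.add_mul, Matrix.add_mulVec, dotProduct_add]
      map_smul' := fun c Y => by
        rw [Matrix.mul_smul, Matrix.smul_mul, Matrix.smul_mulVec, dotProduct_smul]; rfl }
  let L₁ (Y : Matrix (Fin p₂) (Fin p₂) ℝ) : Matrix (Fin p₁) (Fin p₁) ℝ →ₗ[ℝ] ℝ :=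
    { toFun := fun X => η ⬝ᵥ ((X * T₁₂ * Y * (-T₂₂)) *ᵥ w)
      map_add' := fun X Z => by
        simp only [Matrix.add_mul, Matrix.add_mulVec, dotProduct_add]
      map_smul' := fun c X => by
        simp only [Matrix.smul_mul, Matrix.smul_mulVec, dotProduct_smul]; rfl }
  have hinner (θ₁ : ℝ) : ∫ θ₂ in Set.Ioi (0 : ℝ),
      θ₁ ^ m * θ₂ ^ n * Real.exp (-(θ₁ * e₁) - θ₂ * e₂)
        * (η ⬝ᵥ ((matExp (θ₁ • T₁₁) * T₁₂ * matExp (θ₂ • T₂₂) * (-T₂₂)) *ᵥ w))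
      = n.factorial * (θ₁ ^ m * Real.exp (-(θ₁ * e₁))
        * L₁ ((e₂ • 1 - T₂₂)⁻¹ ^ (n + 1)) (matExp (θ₁ • T₁₁))) := by
    trans ∫ θ₂ in Set.Ioi (0 : ℝ), θ₁ ^ m * Real.exp (-(θ₁ * e₁))
      * (θ₂ ^ n * Real.exp (-(θ₂ * e₂)) * L₂ (matExp (θ₁ • T₁₁)) (matExp (θ₂ • T₂₂)))
    · congr 1 with θ₂
      rw [sub_eq_add_neg, Real.exp_add]
      change _ = _ * (_ * (η ⬝ᵥ _))
      ring
    · rw [integral_const_mul, integral_pow_mul_exp_mul_matExp T₂₂ hT₂₂ he₂]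
      exact mul_left_comm _ _ _
  simp_rw [hinner]
  rw [integral_const_mul, integral_pow_mul_exp_mul_matExp T₁₁ hT₁₁ he₁, ← mul_assoc,
    mul_comm (n.factorial : ℝ)]
  rfl

end PhaseType

/-- Posterior cross moments in the bivariate phase-type mixed Poisson
model: for all `k, s ∈ ℕ₀`,
`E(Θ₁^k Θ₂^s ∣ Y = y)`, expressed as a ratio of double integrals against the
unnormalized posterior density, equals
`[(y_{•1}+k)!(y_{•2}+s)!/(y_{•1}! y_{•2}!)]
  · η (e_{•1}I−T₁₁)^{-(y_{•1}+k+1)} T₁₂ (e_{•2}I−T₂₂)^{-(y_{•2}+s+1)} (−T₂₂)𝟙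
  / η (e_{•1}I−T₁₁)^{-(y_{•1}+1)} T₁₂ (e_{•2}I−T₂₂)^{-(y_{•2}+1)} (−T₂₂)𝟙`,
provided the denominator is nonzero. -/
theorem bivariate_phase_type_posterior_cross_moments
    (p₁ p₂ : ℕ)
    (T₁₁ : Matrix (Fin p₁) (Fin p₁) ℝ)
    (hT₁₁ : ∀ z ∈ spectrum ℂ (T₁₁.map Complex.ofReal), z.re < 0)
    (T₂₂ : Matrix (Fin p₂) (Fin p₂) ℝ)
    (hT₂₂ : ∀ z ∈ spectrum ℂ (T₂₂.map Complex.ofReal), z.re < 0)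
    (T₁₂ : Matrix (Fin p₁) (Fin p₂) ℝ)
    (η : Fin p₁ → ℝ)
    (e₁ e₂ : ℝ) (he₁ : 0 < e₁) (he₂ : 0 < e₂)
    (y₁ y₂ : ℕ) (k s : ℕ)
    (hden : η ⬝ᵥ
        (((e₁ • (1 : Matrix (Fin p₁) (Fin p₁) ℝ) - T₁₁)⁻¹ ^ (y₁ + 1)
            * T₁₂
            * (e₂ • (1 : Matrix (Fin p₂) (Fin p₂) ℝ) - T₂₂)⁻¹ ^ (y₂ + 1)
            * (-T₂₂))
          *ᵥ (fun _ => (1 : ℝ))) ≠ 0) :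
    (∫ θ₁ in Set.Ioi (0 : ℝ), ∫ θ₂ in Set.Ioi (0 : ℝ),
        θ₁ ^ k * θ₂ ^ s * θ₁ ^ y₁ * θ₂ ^ y₂
          * Real.exp (-(θ₁ * e₁) - θ₂ * e₂)
          * (η ⬝ᵥ ((matExp (θ₁ • T₁₁) * T₁₂ * matExp (θ₂ • T₂₂) * (-T₂₂))
              *ᵥ (fun _ => (1 : ℝ)))))
      / (∫ θ₁ in Set.Ioi (0 : ℝ), ∫ θ₂ in Set.Ioi (0 : ℝ),
          θ₁ ^ y₁ * θ₂ ^ y₂ * Real.exp (-(θ₁ * e₁) - θ₂ * e₂)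
            * (η ⬝ᵥ ((matExp (θ₁ • T₁₁) * T₁₂ * matExp (θ₂ • T₂₂) * (-T₂₂))
                *ᵥ (fun _ => (1 : ℝ)))))
    = (((y₁ + k).factorial : ℝ) * ((y₂ + s).factorial : ℝ)
          / ((y₁.factorial : ℝ) * (y₂.factorial : ℝ)))
        * (η ⬝ᵥ
            (((e₁ • (1 : Matrix (Fin p₁) (Fin p₁) ℝ) - T₁₁)⁻¹ ^ (y₁ + k + 1)
                * T₁₂
                * (e₂ • (1 : Matrix (Fin p₂) (Fin p₂) ℝ) - T₂₂)⁻¹ ^ (y₂ + s + 1)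
                * (-T₂₂))
              *ᵥ (fun _ => (1 : ℝ))))
        / (η ⬝ᵥ
            (((e₁ • (1 : Matrix (Fin p₁) (Fin p₁) ℝ) - T₁₁)⁻¹ ^ (y₁ + 1)
                * T₁₂
                * (e₂ • (1 : Matrix (Fin p₂) (Fin p₂) ℝ) - T₂₂)⁻¹ ^ (y₂ + 1)
                * (-T₂₂))
              *ᵥ (fun _ => (1 : ℝ)))) := by
  have hnum : ∀ θ₁ θ₂ : ℝ, θ₁ ^ k * θ₂ ^ s * θ₁ ^ y₁ * θ₂ ^ y₂
      = θ₁ ^ (y₁ + k) * θ₂ ^ (y₂ + s) := fun θ₁ θ₂ => by ring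
  simp_rw [hnum]
  rw [phase_type_double_integral T₁₁ hT₁₁ T₂₂ hT₂₂ T₁₂ η _ he₁ he₂,
    phase_type_double_integral T₁₁ hT₁₁ T₂₂ hT₂₂ T₁₂ η _ he₁ he₂]
  have h₁ : (y₁.factorial : ℝ) ≠ 0 := Nat.cast_ne_zero.mpr y₁.factorial_ne_zero
  have h₂ : (y₂.factorial : ℝ) ≠ 0 := Nat.cast_ne_zero.mpr y₂.factorial_ne_zero
  field_simp
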